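/- Let A be a k-algebra with center Z. If Z/N(Z) is generated as a k-algebra by a set of units of Z/N(Z), then A is strongly cancellative and strongly Morita cancellative. -/

import Mathlib

open scoped TensorProduct

universe u

/-- The polynomial extension `A[t₁,…,tₙ]` of a (possibly noncommutative) `k`-algebra `A`
in `n` central, mutually commuting indeterminates. -/
abbrev PolyExt (A : Type u) [Ring A] (n : ℕ) : Type u :=
  AddMonoidAlgebra A (Fin n →₀ ℕ)

/-- The canonical embedding `A → A[t₁,…,tₙ]` as constant polynomials. -/
noncomputable def PolyExt.C (k A : Type u) [Field k] [Ring A] [Algebra k A] (n : ℕ) :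
    A →ₐ[k] PolyExt A n :=
  AddMonoidAlgebra.singleZeroAlgHom

/-- The `i`-th indeterminate of `A[t₁,…,tₙ]`. -/
noncomputable def PolyExt.X (A : Type u) [Ring A] (n : ℕ) (i : Fin n) : PolyExt A n :=
  AddMonoidAlgebra.single (Finsupp.single i 1) 1

/-- Two rings are Morita equivalent if their categories of right modules are
equivalent (as abelian categories). -/
def MoritaEquivalent (R S : Type u) [Ring R] [Ring S] : Prop :=
  Nonempty (ModuleCat.{u} Rᵐᵒᵖ ≌ ModuleCat.{u} Sᵐᵒᵖ)

/-- `A` is strongly cancellative: for every `n ≥ 1` and every `k`-algebra `B`, any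
`k`-algebra isomorphism `A[s₁,…,sₙ] ≅ B[t₁,…,tₙ]` implies `A ≅ B`. -/
def StronglyCancellative (k A : Type u) [Field k] [Ring A] [Algebra k A] : Prop :=
  ∀ (n : ℕ), 1 ≤ n → ∀ (B : Type u) [Ring B] [Algebra k B],
    Nonempty (PolyExt A n ≃ₐ[k] PolyExt B n) → Nonempty (A ≃ₐ[k] B)

/-- `A` is strongly Morita cancellative: for every `n ≥ 1` and every `k`-algebra `B`,
Morita equivalence of `A[s₁,…,sₙ]` and `B[t₁,…,tₙ]` implies Morita equivalence of `A` and `B`. -/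
def StronglyMoritaCancellative (k A : Type u) [Field k] [Ring A] [Algebra k A] : Prop :=
  ∀ (n : ℕ), 1 ≤ n → ∀ (B : Type u) [Ring B] [Algebra k B],
    MoritaEquivalent (PolyExt A n) (PolyExt B n) → MoritaEquivalent A B

/-- `A` is strongly retractable: every `k`-algebra isomorphism
`φ : A[s₁,…,sₙ] → B[t₁,…,tₙ]` (with `n ≥ 1`) satisfies `φ(A) = B`. -/
def StronglyRetractable (k A : Type u) [Field k] [Ring A] [Algebra k A] : Prop :=
  ∀ (n : ℕ), 1 ≤ n → ∀ (B : Type u) [Ring B] [Algebra k B]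
    (φ : PolyExt A n ≃ₐ[k] PolyExt B n),
    φ '' Set.range (PolyExt.C k A n) = Set.range (PolyExt.C k B n)

/-- `A` is strongly detectable: for every `k`-algebra isomorphism
`φ : A[s₁,…,sₙ] → B[t₁,…,tₙ]` (with `n ≥ 1`), the subalgebra of `B[t₁,…,tₙ]` generated by
`B` together with `φ(s₁),…,φ(sₙ)` is all of `B[t₁,…,tₙ]`. -/
def StronglyDetectable (k A : Type u) [Field k] [Ring A] [Algebra k A] : Prop :=
  ∀ (n : ℕ), 1 ≤ n → ∀ (B : Type u) [Ring B] [Algebra k B]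
    (φ : PolyExt A n ≃ₐ[k] PolyExt B n),
    Algebra.adjoin k
      (Set.range (PolyExt.C k B n) ∪ Set.range fun i => φ (PolyExt.X A n i)) = ⊤

theorem RingHom.injective_of_surjective_of_isNoetherianRing {R : Type*} [CommRing R]
    [IsNoetherianRing R] (f : R →+* R) (hf : Function.Surjective f) : Function.Injective f := by
  have hit (n : ℕ) (x : R) : (f ^ n) x = f^[n] x := by rw [RingHom.coe_pow]
  let K : ℕ →o Ideal R :=
    ⟨fun n => RingHom.ker (f ^ n), monotone_nat_of_le_succ fun n x hx => by
      rw [RingHom.mem_ker, hit] at hx ⊢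
      rw [Function.iterate_succ_apply', hx, map_zero]⟩
  obtain ⟨n, hn⟩ := monotone_stabilizes_iff_noetherian.mpr ‹IsNoetherianRing R› K
  refine (injective_iff_map_eq_zero f).mpr fun x hx => ?_
  obtain ⟨y, rfl⟩ := hf.iterate n x
  have hy : y ∈ K (n + 1) := by
    change (f ^ (n + 1)) y = 0
    rw [hit, Function.iterate_succ_apply', hx]
  rw [← hn (n + 1) n.le_succ] at hy
  exact (hit n y).symm.trans hy

theorem MvPolynomial.injective_of_surjective {σ R : Type*} [Finite σ] [CommRing R]
    (f : MvPolynomial σ R →ₐ[R] MvPolynomial σ R) (hf : Function.Surjective f) :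
    Function.Injective f := by
  refine (injective_iff_map_eq_zero f).mpr fun p hp => ?_
  choose g hg using fun i => hf (X i)
  let s : Set R := p.coeffs ∪ ((⋃ i, ((f (X i)).coeffs : Set R)) ∪ ⋃ i, ((g i).coeffs : Set R))
  have hs : s.Finite := (Finset.finite_toSet _).union
    ((Set.finite_iUnion fun i => Finset.finite_toSet _).union
      (Set.finite_iUnion fun i => Finset.finite_toSet _))
  let S := Algebra.adjoin ℤ s
  have : IsNoetherianRing S := isNoetherianRing_of_fg ⟨hs.toFinset, by simp [S]⟩
  have lift (q : MvPolynomial σ R) (hq : (q.coeffs : Set R) ⊆ s) :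
      ∃ q' : MvPolynomial σ S, map (algebraMap S R) q' = q :=
    mem_range_map_iff_coeffs_subset.mpr fun x hx =>
      ⟨⟨x, Algebra.subset_adjoin (hq hx)⟩, rfl⟩
  obtain ⟨p', hp'⟩ := lift p Set.subset_union_left
  choose a ha using fun i => lift (f (X i)) fun x hx =>
    Or.inr (Or.inl (Set.mem_iUnion.mpr ⟨i, hx⟩))
  choose g' hg' using fun i => lift (g i) fun x hx => 
    Or.inr (Or.inr (Set.mem_iUnion.mpr ⟨i, hx⟩))
  have hinj : Function.Injective (map (σ := σ) (algebraMap S R)) :=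
    map_injective _ Subtype.val_injective
  have hcomm (q : MvPolynomial σ S) :
      map (algebraMap S R) (aeval a q) = f (map (algebraMap S R) q) := by
    induction q using MvPolynomial.induction_on with
    | C r => simp [MvPolynomial.algHom_C]
    | add q r hq hr => simp only [map_add, hq, hr]
    | mul_X q i hq => simp only [map_mul, hq, aeval_X, map_X, ha]
  have hsurj : Function.Surjective (aeval a : MvPolynomial σ S →ₐ[S] MvPolynomial σ S) := by
    rw [← AlgHom.range_eq_top, eq_top_iff, ← MvPolynomial.adjoin_range_X, Algebra.adjoin_le_iff]
    rintro _ ⟨i, rfl⟩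
    exact ⟨g' i, hinj ((hcomm _).trans (by rw [hg', hg, map_X]))⟩
  have := RingHom.injective_of_surjective_of_isNoetherianRing
    (aeval a : MvPolynomial σ S →ₐ[S] MvPolynomial σ S).toRingHom hsurj
  have h0 : p' = 0 := this (hinj ((hcomm p').trans (by rw [hp', hp]; exact (map_zero _).symm)))
  rw [← hp', h0, map_zero]

theorem IsUnit.of_quotient_mk_nilradical {R : Type*} [CommRing R] {x : R}
    (hx : IsUnit (Ideal.Quotient.mk (nilradical R) x)) : IsUnit x := by
  obtain ⟨y, hy⟩ := hx.exists_right_inv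
  obtain ⟨y, rfl⟩ := Ideal.Quotient.mk_surjective y
  rw [← map_mul, ← map_one (Ideal.Quotient.mk _), Ideal.Quotient.mk_eq_mk_iff_sub_mem,
    mem_nilradical] at hy
  have := hy.isUnit_add_one
  rw [sub_add_cancel] at this
  exact isUnit_of_mul_isUnit_left this

/-- A commutative ring is generated, as a ring, by its units and its nilpotent elements. -/
def GeneratedByUnitsAndNilpotents (R : Type*) [CommRing R] : Prop :=
  ∀ T : Subring R, (∀ u, IsUnit u → u ∈ T) → (∀ x, IsNilpotent x → x ∈ T) → T = ⊤

theorem GeneratedByUnitsAndNilpotents.of_ringEquiv {R S : Type*} [CommRing R] [CommRing S]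
    (e : R ≃+* S) (h : GeneratedByUnitsAndNilpotents R) : GeneratedByUnitsAndNilpotents S := by
  intro T hu hn
  have := h (T.comap e.toRingHom) (fun u hu' => hu _ (hu'.map e)) fun x hx => hn _ (hx.map e)
  refine eq_top_iff.mpr fun x _ => ?_
  have hx : e.symm x ∈ T.comap e.toRingHom := this ▸ Subring.mem_top _
  simpa using hx

theorem generatedByUnitsAndNilpotents_of_quotient {k Z : Type*} [Field k] [CommRing Z] [Algebra k Z]
    (h : ∃ S : Set (Z ⧸ nilradical Z), (∀ s ∈ S, IsUnit s) ∧ Algebra.adjoin k S = ⊤) :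
    GeneratedByUnitsAndNilpotents Z := by
  obtain ⟨S, hS, hadj⟩ := h
  intro T hu hn
  let T' : Subalgebra k Z :=
    { T with
      algebraMap_mem' := fun c => by
        obtain rfl | hc := eq_or_ne c 0
        · simp
        · exact hu _ ((IsUnit.mk0 c hc).map (algebraMap k Z)) }
  have hT' : T'.map (Ideal.Quotient.mkₐ k (nilradical Z)) = ⊤ := by
    rw [eq_top_iff, ← hadj, Algebra.adjoin_le_iff]
    intro s hs
    obtain ⟨z, rfl⟩ := Ideal.Quotient.mk_surjective s
    exact ⟨z, hu z (hS _ hs).of_quotient_mk_nilradical, rfl⟩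
  refine eq_top_iff.mpr fun z _ => ?_
  obtain ⟨t, ht, hz⟩ : Ideal.Quotient.mk (nilradical Z) z ∈
    T'.map (Ideal.Quotient.mkₐ k (nilradical Z)) := hT' ▸ Algebra.mem_top
  have := T.sub_mem ht (hn _ (mem_nilradical.mp ((Ideal.Quotient.mk_eq_mk_iff_sub_mem t z).mp hz)))
  simpa using this

namespace MvPolynomial

variable {σ R : Type*} [Finite σ] [CommRing R]

/-- An endomorphism of a polynomial algebra that is surjective modulo nilpotents is surjective. -/
theorem surjective_of_surjective_mod_nilradical
    (f : MvPolynomial σ R →ₐ[R] MvPolynomial σ R)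
    (hf : ∀ i, ∃ g, IsNilpotent (X i - f g)) : Function.Surjective f := by
  choose g hg using hf
  let s : Set R := ⋃ i, ((X i - f (g i)).coeffs : Set R)
  have hs : s.Finite := Set.finite_iUnion fun i => Finset.finite_toSet _
  let J : Ideal R := Ideal.span s
  have hJ : IsNilpotent J := by
    rw [Ideal.FG.isNilpotent_iff_le_nilradical ⟨hs.toFinset, by simp [J]⟩, Ideal.span_le]
    intro c hc
    obtain ⟨i, hi⟩ := Set.mem_iUnion.mp hc
    obtain ⟨m, -, rfl⟩ := mem_coeffs_iff.mp hi
    exact isNilpotent_iff.mp (hg i) m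
  have hmem (i : σ) : X i - f (g i) ∈ J.map C := by
    rw [mem_map_C_iff]
    intro m
    by_cases hm : m ∈ (X i - f (g i)).support
    · exact Ideal.subset_span (Set.mem_iUnion.mpr ⟨i, mem_coeffs_iff.mpr ⟨m, hm, rfl⟩⟩)
    · rw [notMem_support_iff.mp hm]
      exact J.zero_mem
  let N : Submodule R (MvPolynomial σ R) := LinearMap.range f.toLinearMap
  let I := J.map (C : R →+* MvPolynomial σ R)
  have hone : (⊤ : Submodule R (MvPolynomial σ R)) ≤ N ⊔ J • ⊤ := by
    have hr : ((Ideal.Quotient.mkₐ R I).comp f).range = (Ideal.Quotient.mkₐ R I).range := by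
      refine le_antisymm (AlgHom.range_comp_le_range _ _) ?_
      rw [← Algebra.map_top, ← MvPolynomial.adjoin_range_X, AlgHom.map_adjoin,
        Algebra.adjoin_le_iff]
      rintro _ ⟨_, ⟨i, rfl⟩, rfl⟩
      exact ⟨g i, ((Ideal.Quotient.mk_eq_mk_iff_sub_mem _ _).mpr (hmem i)).symm⟩
    intro p _
    obtain ⟨q, hq⟩ : Ideal.Quotient.mkₐ R I p ∈ ((Ideal.Quotient.mkₐ R I).comp f).range :=
      hr ▸ ⟨p, rfl⟩
    have hpq : p - f q ∈ I := (Ideal.Quotient.mk_eq_mk_iff_sub_mem _ _).mp hq.symm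
    refine Submodule.mem_sup.mpr ⟨f q, ⟨q, rfl⟩, p - f q, ?_, by simp⟩
    rw [Ideal.smul_top_eq_map]
    exact hpq
  have hpow (n : ℕ) : (⊤ : Submodule R (MvPolynomial σ R)) ≤ N ⊔ J ^ n • ⊤ := by
    induction n with
    | zero => rw [pow_zero, Ideal.one_eq_top, Submodule.top_smul]; exact le_sup_right
    | succ n ih =>
      calc ⊤ ≤ N ⊔ J ^ n • ⊤ := ih
        _ ≤ N ⊔ J ^ n • (N ⊔ J • ⊤) := by gcongr
        _ ≤ N ⊔ J ^ (n + 1) • ⊤ := by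
          rw [Submodule.smul_sup, ← Submodule.mul_smul, ← pow_succ]
          exact sup_le le_sup_left
            (sup_le (Submodule.smul_le_right.trans le_sup_left) le_sup_right)
  obtain ⟨n, hn⟩ := hJ
  intro p
  have hp := hpow n (Submodule.mem_top (x := p))
  rw [hn, Ideal.zero_eq_bot, Submodule.bot_smul, sup_bot_eq] at hp
  exact hp

/-- Let `Z` be generated by units and nilpotents. Under any isomorphism `Z[s] ≅ R[t]`, the images
of the variables `s` are polynomial generators of `R[t]` over `R`. -/
theorem bijective_aeval_of_ringEquiv {Z : Type*} [CommRing Z]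
    (hZ : GeneratedByUnitsAndNilpotents Z) (e : MvPolynomial σ Z ≃+* MvPolynomial σ R) :
    Function.Bijective
      (aeval fun i => e (X i) : MvPolynomial σ R →ₐ[R] MvPolynomial σ R) := by
  set f : MvPolynomial σ R →ₐ[R] MvPolynomial σ R := aeval fun i => e (X i)
  suffices hf : Function.Surjective f from ⟨injective_of_surjective f hf, hf⟩
  let mk := Ideal.Quotient.mkₐ R (nilradical (MvPolynomial σ R))
  have hmk {p : MvPolynomial σ R} (hp : IsNilpotent p) : mk p = 0 :=
    Ideal.Quotient.eq_zero_iff_mem.mpr (mem_nilradical.mpr hp)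
  let T : Subring (MvPolynomial σ Z) :=
    (mk.comp f).range.toSubring.comap (mk.toRingHom.comp e.toRingHom)
  have hC : T.comap C = ⊤ := by
    refine hZ _ (fun u hu => ?_) fun x hx => ?_
    · have hu' := isUnit_iff.mp ((hu.map C).map e)
      have hnil : IsNilpotent (e (C u) - C ((e (C u)).coeff 0)) := by
        classical
        rw [isNilpotent_iff]
        intro m
        by_cases hm : m = 0
        · simp [hm]
        · simpa [Ne.symm hm] using hu'.2 m hm
      refine ⟨C ((e (C u)).coeff 0), ?_⟩
      have := hmk hnil
      rw [map_sub, sub_eq_zero] at this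
      refine Eq.trans ?_ this.symm
      simp [f]
    · exact ⟨0, (map_zero _).trans (hmk ((hx.map C).map e)).symm⟩
  have hT (p : MvPolynomial σ Z) : p ∈ T := by
    induction p using MvPolynomial.induction_on with
    | C z => exact (hC ▸ Subring.mem_top z : z ∈ T.comap C)
    | add p q hp hq => exact T.add_mem hp hq
    | mul_X p i hp => exact T.mul_mem hp ⟨X i, by simp [f]⟩
  refine surjective_of_surjective_mod_nilradical f fun i => ?_
  obtain ⟨q, hq⟩ := hT (e.symm (X i))
  refine ⟨q, mem_nilradical.mp ((Ideal.Quotient.mk_eq_mk_iff_sub_mem _ _).mp ?_)⟩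
  simpa [mk] using hq.symm

end MvPolynomial

namespace PolyExt

variable {A : Type u} [Ring A] {n : ℕ}

/-- The inclusion of `Z(A)[t₁,…,tₙ]` into `A[t₁,…,tₙ]`. -/
noncomputable def ofCenter (A : Type u) [Ring A] (n : ℕ) :
    MvPolynomial (Fin n) (Subring.center A) →+* PolyExt A n :=
  AddMonoidAlgebra.mapRingHom _ (Subring.center A).subtype

theorem ofCenter_injective : Function.Injective (ofCenter A n) := by
  intro p q h
  ext m
  have := congrArg (fun f => f.coeff m) h
  simp only [ofCenter, AddMonoidAlgebra.coeff_mapRingHom] at this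
  exact this

theorem ofCenter_C (z : Subring.center A) :
    ofCenter A n (MvPolynomial.C z) = AddMonoidAlgebra.single 0 (z : A) :=
  AddMonoidAlgebra.mapRingHom_single _ _ _

theorem ofCenter_X (i : Fin n) : ofCenter A n (MvPolynomial.X i) = X A n i :=
  AddMonoidAlgebra.mapRingHom_single _ _ _

theorem mem_center_iff {f : PolyExt A n} :
    f ∈ Subring.center (PolyExt A n) ↔ ∃ p, ofCenter A n p = f := by
  constructor
  · intro hf
    have hc (m) : f.coeff m ∈ Subring.center A := by
      rw [Subring.mem_center_iff] at hf ⊢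
      intro a
      have := congrArg (fun g => g.coeff m) (hf (AddMonoidAlgebra.single 0 a))
      simpa only [AddMonoidAlgebra.coeff_mul_single_zero, AddMonoidAlgebra.coeff_single_zero_mul]
        using this
    refine ⟨.ofCoeff (Finsupp.onFinset f.coeff.support (fun m => ⟨f.coeff m, hc m⟩) ?_), ?_⟩
    · intro m hm
      simpa [Subtype.ext_iff] using hm
    · ext m
      simp [ofCenter]
  · rintro ⟨p, rfl⟩
    rw [Subring.mem_center_iff]
    intro g
    induction p using MvPolynomial.induction_on with
    | C z =>
      rw [ofCenter_C]
      ext m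
      simp only [AddMonoidAlgebra.coeff_mul_single_zero, AddMonoidAlgebra.coeff_single_zero_mul,
        Subring.mem_center_iff.mp z.2]
    | add p q hp hq => rw [map_add, mul_add, add_mul, hp, hq]
    | mul_X p i hp =>
      have hX : g * ofCenter A n (MvPolynomial.X i) = ofCenter A n (MvPolynomial.X i) * g := by
        rw [ofCenter_X, X]
        clear hp
        induction g using AddMonoidAlgebra.induction_linear with
        | zero => simp
        | add f g hf hg => rw [add_mul, mul_add, hf, hg]
        | single m a => simp [AddMonoidAlgebra.single_mul_single, add_comm]
      rw [map_mul, ← mul_assoc, hp, mul_assoc, hX, mul_assoc]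

/-- The center of `A[t₁,…,tₙ]` is `Z(A)[t₁,…,tₙ]`. -/
noncomputable def centerEquiv (A : Type u) [Ring A] (n : ℕ) :
    MvPolynomial (Fin n) (Subring.center A) ≃+* Subring.center (PolyExt A n) :=
  RingEquiv.ofBijective
    ((ofCenter A n).codRestrict (Subring.center (PolyExt A n)) fun p => mem_center_iff.mpr ⟨p, rfl⟩)
    ⟨fun _ _ h => ofCenter_injective (congrArg Subtype.val h), fun f =>
      let ⟨p, hp⟩ := mem_center_iff.mp f.2
      ⟨p, Subtype.ext hp⟩⟩

theorem coe_centerEquiv (p : MvPolynomial (Fin n) (Subring.center A)) :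
    (centerEquiv A n p : PolyExt A n) = ofCenter A n p :=
  rfl

/-- Evaluation of a polynomial at central elements of the coefficient ring. -/
noncomputable def evalCenter (c : Fin n → Subring.center A) : PolyExt A n →+* A :=
  AddMonoidAlgebra.liftNCRingHom (RingHom.id A)
    { toFun := fun m => (MvPolynomial.aeval c (MvPolynomial.monomial m.toAdd (1 : Subring.center A)) :
        Subring.center A)
      map_one' := by
        rw [toAdd_one, MvPolynomial.monomial_zero', map_one, map_one, Subring.coe_one]
      map_mul' := fun l m => by
        rw [toAdd_mul, ← Subring.coe_mul, ← map_mul, MvPolynomial.monomial_mul, one_mul] }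
    fun a _ => Subring.mem_center_iff.mp (SetLike.coe_mem _) a

theorem evalCenter_single (c : Fin n → Subring.center A) (m : Fin n →₀ ℕ) (a : A) :
    evalCenter c (AddMonoidAlgebra.single m a) =
      a * (MvPolynomial.aeval c (MvPolynomial.monomial m (1 : Subring.center A)) :
        Subring.center A) :=
  AddMonoidAlgebra.liftNCRingHom_single _ _ _ _ _

theorem evalCenter_single_zero (c : Fin n → Subring.center A) (a : A) :
    evalCenter c (AddMonoidAlgebra.single 0 a) = a := by
  rw [evalCenter_single, MvPolynomial.monomial_zero', map_one, map_one, Subring.coe_one, mul_one]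

theorem evalCenter_ofCenter (c : Fin n → Subring.center A)
    (p : MvPolynomial (Fin n) (Subring.center A)) :
    evalCenter c (ofCenter A n p) = MvPolynomial.aeval c p := by
  induction p using MvPolynomial.induction_on with
  | C z => simp [ofCenter_C, evalCenter_single_zero, MvPolynomial.algHom_C]
  | add p q hp hq => simp only [map_add, hp, hq, Subring.coe_add]
  | mul_X p i hp =>
    have : evalCenter c (X A n i) = c i := by
      rw [X, evalCenter_single, one_mul]
      exact congrArg Subtype.val (MvPolynomial.aeval_X c i)
    rw [map_mul, map_mul, hp, ofCenter_X, this, map_mul, MvPolynomial.aeval_X, Subring.coe_mul]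

/-- If `θ` is a `Z(A)`-automorphism of `Z(A)[t₁,…,tₙ]`, then `A[t₁,…,tₙ] / (θ(t₁),…,θ(tₙ))` is `A`. -/
theorem exists_retraction_of_bijective
    (θ : MvPolynomial (Fin n) (Subring.center A) →ₐ[Subring.center A]
      MvPolynomial (Fin n) (Subring.center A)) (hθ : Function.Bijective θ) :
    ∃ ρ : PolyExt A n →+* A, (∀ a, ρ (AddMonoidAlgebra.single 0 a) = a) ∧
      RingHom.ker ρ = Ideal.span (Set.range fun i => ofCenter A n (θ (MvPolynomial.X i))) := by
  let θ' := AlgEquiv.ofBijective θ hθ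
  let ε : MvPolynomial (Fin n) (Subring.center A) →ₐ[Subring.center A] Subring.center A :=
    MvPolynomial.aeval 0
  let ρ := evalCenter fun i => ε (θ'.symm (MvPolynomial.X i))
  have hρ (p) : ρ (ofCenter A n p) = ε (θ'.symm p) := by
    rw [evalCenter_ofCenter]
    congr 1
    refine DFunLike.congr_fun (?_ : MvPolynomial.aeval _ = ε.comp θ'.symm.toAlgHom) p
    ext i
    simp
  let I := Ideal.span (Set.range fun i => ofCenter A n (θ (MvPolynomial.X i)))
  refine ⟨ρ, evalCenter_single_zero _, le_antisymm ?_ ?_⟩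
  · have hker (p : MvPolynomial (Fin n) (Subring.center A)) :
        p - MvPolynomial.C (ε p) ∈ Ideal.span (Set.range MvPolynomial.X) := by
      let mk := Ideal.Quotient.mkₐ (Subring.center A)
        (Ideal.span (Set.range (MvPolynomial.X (R := Subring.center A) (σ := Fin n))))
      have hmk : mk = (mk.comp (Algebra.ofId _ _)).comp ε := by
        ext i
        have : mk (MvPolynomial.X i) = 0 :=
          Ideal.Quotient.eq_zero_iff_mem.mpr (Ideal.subset_span ⟨i, rfl⟩)
        simp [ε, this]
      exact (Ideal.Quotient.mk_eq_mk_iff_sub_mem _ _).mp (DFunLike.congr_fun hmk p)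
    have hcenter (p : MvPolynomial (Fin n) (Subring.center A)) :
        ofCenter A n p - AddMonoidAlgebra.single 0 (ρ (ofCenter A n p)) ∈ I := by
      have hle : Ideal.span (Set.range MvPolynomial.X) ≤
          I.comap ((ofCenter A n).comp θ.toRingHom) := by
        rw [Ideal.span_le]
        rintro _ ⟨i, rfl⟩
        exact Ideal.subset_span ⟨i, rfl⟩
      have hp := hle (hker (θ'.symm p))
      have hθ' : θ (θ'.symm p) = p := θ'.apply_symm_apply p
      have hC (z) : θ (MvPolynomial.C z) = MvPolynomial.C z := MvPolynomial.algHom_C ..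
      simp only [Ideal.mem_comap, RingHom.comp_apply, AlgHom.toRingHom_eq_coe,
        RingHom.coe_coe, map_sub, hθ', hC,
        ofCenter_C] at hp
      rwa [hρ]
    intro f hf
    have : f - AddMonoidAlgebra.single 0 (ρ f) ∈ I := by
      clear hf
      induction f using AddMonoidAlgebra.induction_linear with
      | zero => simp
      | add f g hf hg =>
        rw [map_add, AddMonoidAlgebra.single_add, add_sub_add_comm]
        exact I.add_mem hf hg
      | single m a =>
        have hs : (AddMonoidAlgebra.single m a : PolyExt A n) =
            AddMonoidAlgebra.single 0 a * ofCenter A n (MvPolynomial.monomial m 1) := by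
          have : ofCenter A n (MvPolynomial.monomial m 1) = AddMonoidAlgebra.single m 1 :=
            AddMonoidAlgebra.mapRingHom_single _ _ _
          rw [this, AddMonoidAlgebra.single_mul_single, zero_add, mul_one]
        have := I.mul_mem_left (AddMonoidAlgebra.single 0 a)
          (hcenter (MvPolynomial.monomial m 1))
        rwa [mul_sub, ← hs, AddMonoidAlgebra.single_mul_single, zero_add,
          ← evalCenter_single_zero (n := n) (fun i => ε (θ'.symm (MvPolynomial.X i))) a,
          ← map_mul, evalCenter_single_zero, ← hs] at this
    rw [RingHom.mem_ker.mp hf, AddMonoidAlgebra.single_zero, sub_zero] at this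
    exact this
  · rw [Ideal.span_le]
    rintro _ ⟨i, rfl⟩
    have : θ (MvPolynomial.X i) = θ' (MvPolynomial.X i) := rfl
    simp [hρ, this, ε]

end PolyExt

section CenterOfModuleCat

open CategoryTheory

/-- Multiplication by a central element, as an endomorphism of a module. -/
def ModuleCat.centralSmul {R : Type u} [Ring R] (z : Subring.center R) (M : ModuleCat.{u} R) :
    M ⟶ M :=
  ModuleCat.ofHom
    { toFun := fun m => (z : R) • m
      map_add' := smul_add _
      map_smul' := fun r m => by
        rw [RingHom.id_apply, smul_smul, smul_smul, Subring.mem_center_iff.mp z.2 r] }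

variable {R S : Type u} [Ring R] [Ring S]

namespace ModuleCat

theorem centralSmul_naturality (z : Subring.center R) {M N : ModuleCat.{u} R} (f : M ⟶ N) :
    centralSmul z M ≫ f = f ≫ centralSmul z N := by
  ext m
  exact f.hom.map_smul _ _

theorem centralSmul_add (z w : Subring.center R) (M : ModuleCat.{u} R) :
    centralSmul (z + w) M = centralSmul z M + centralSmul w M := by
  ext m
  exact add_smul _ _ _

theorem centralSmul_mul (z w : Subring.center R) (M : ModuleCat.{u} R) :
    centralSmul (z * w) M = centralSmul w M ≫ centralSmul z M := by
  ext m
  exact mul_smul _ _ _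

theorem centralSmul_of_self_injective {z w : Subring.center R}
    (h : centralSmul z (of R R) = centralSmul w (of R R)) : z = w := by
  have : (z : R) * 1 = w * 1 := congrArg (fun f => f.hom (1 : R)) h
  exact Subtype.ext (by rwa [mul_one, mul_one] at this)

theorem centralSmul_eq_zero_iff (z : Subring.center R) (M : ModuleCat.{u} R) :
    centralSmul z M = 0 ↔ ∀ m : M, (z : R) • m = 0 := by
  rw [ModuleCat.hom_ext_iff, LinearMap.ext_iff]
  rfl

/-- Every natural endomorphism of the identity functor is multiplication by a central element. -/
theorem exists_centralSmul_eq_app (η : 𝟭 (ModuleCat.{u} R) ⟶ 𝟭 (ModuleCat.{u} R)) :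
    ∃ z : Subring.center R, ∀ M, η.app M = centralSmul z M := by
  let z : R := (η.app (of R R)).hom (1 : R)
  have hη (M : ModuleCat.{u} R) (m : M) : (η.app M).hom m = z • m := by
    have : (η.app M).hom ((1 : R) • m) = z • m := congrArg (fun f => f.hom (1 : R))
      (η.naturality (ofHom (LinearMap.toSpanSingleton R M m)))
    rwa [one_smul] at this
  refine ⟨⟨z, Subring.mem_center_iff.mpr fun r => ?_⟩, fun M => ?_⟩
  · have h : (η.app (of R R)).hom (r • (1 : R)) = z * r := by
      rw [smul_eq_mul, mul_one]
      exact hη (of R R) r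
    exact ((η.app (of R R)).hom.map_smul r (1 : R)).symm.trans h
  · ext m
    exact hη M m

end ModuleCat

namespace CategoryTheory.Equivalence

variable (F : ModuleCat.{u} R ≌ ModuleCat.{u} S)

theorem exists_map_centralSmul (z : Subring.center R) :
    ∃ w : Subring.center S, ∀ M, F.functor.map (ModuleCat.centralSmul z M) =
      ModuleCat.centralSmul w (F.functor.obj M) := by
  let η : 𝟭 (ModuleCat.{u} S) ⟶ 𝟭 (ModuleCat.{u} S) :=
    { app := fun N => F.counitInv.app N ≫
        F.functor.map (ModuleCat.centralSmul z (F.inverse.obj N)) ≫ F.counit.app N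
      naturality := fun N N' f => by
        have h := F.counitInv.naturality f
        have h' := F.counit.naturality f
        simp only [Functor.id_obj, Functor.id_map, Functor.comp_map] at h h' ⊢
        rw [reassoc_of% h, ← Functor.map_comp_assoc, ← ModuleCat.centralSmul_naturality,
          Functor.map_comp_assoc, h', Category.assoc, Category.assoc] }
  obtain ⟨w, hw⟩ := ModuleCat.exists_centralSmul_eq_app η
  refine ⟨w, fun M => ?_⟩
  rw [← hw]
  have h : F.counitInv.app (F.functor.obj M) = F.functor.map (F.unit.app M) :=
    F.counitInv_app_functor M
  simp only [η, h]
  have hz : ModuleCat.centralSmul z M ≫ F.unit.app M =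
      F.unit.app M ≫ ModuleCat.centralSmul z (F.inverse.obj (F.functor.obj M)) :=
    ModuleCat.centralSmul_naturality z _
  rw [← Functor.map_comp_assoc, ← hz, Functor.map_comp_assoc]
  simp

/-- The ring isomorphism between the centers of Morita equivalent rings. -/
theorem exists_centerEquiv : ∃ e : Subring.center R ≃+* Subring.center S,
    ∀ z M, F.functor.map (ModuleCat.centralSmul z M) =
      ModuleCat.centralSmul (e z) (F.functor.obj M) := by
  have : F.functor.Additive := Functor.additive_of_preserves_binary_products _
  choose c hc using F.exists_map_centralSmul
  have huniq {w w' : Subring.center S} (h : ∀ M, ModuleCat.centralSmul w (F.functor.obj M) =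
      ModuleCat.centralSmul w' (F.functor.obj M)) : w = w' := by
    let i : F.functor.obj (F.inverse.obj (ModuleCat.of S S)) ≅ ModuleCat.of S S :=
      F.counitIso.app (ModuleCat.of S S)
    apply ModuleCat.centralSmul_of_self_injective
    rw [← cancel_epi i.hom, ← ModuleCat.centralSmul_naturality, ← ModuleCat.centralSmul_naturality]
    exact congrArg (· ≫ i.hom) (h (F.inverse.obj _))
  have hinj : Function.Injective c := fun z z' h =>
    ModuleCat.centralSmul_of_self_injective (F.functor.map_injective (by rw [hc, hc, h]))
  have hsurj : Function.Surjective c := fun w => by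
    obtain ⟨z, hz⟩ := F.symm.exists_map_centralSmul w
    refine ⟨z, huniq fun M => ?_⟩
    rw [← hc]
    let i := F.unitIso.app M
    have h : ModuleCat.centralSmul z M = i.hom ≫
        F.inverse.map (ModuleCat.centralSmul w (F.functor.obj M)) ≫ i.inv := by
      have := hz (F.functor.obj M)
      rw [← Category.assoc, Iso.eq_comp_inv, ModuleCat.centralSmul_naturality]
      exact congrArg (i.hom ≫ ·) this.symm
    rw [h]
    simp [i]
  refine ⟨RingEquiv.ofBijective
    (RingHom.mk' ⟨⟨c, huniq fun M => ?_⟩, fun z w => huniq fun M => ?_⟩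
      fun z w => huniq fun M => ?_) ⟨hinj, hsurj⟩, hc⟩
  · rw [← hc]
    have h1 (T : Type u) [Ring T] (N : ModuleCat.{u} T) : ModuleCat.centralSmul 1 N = 𝟙 N := by
      ext m
      exact one_smul _ _
    rw [h1, h1, Functor.map_id]
  · rw [← hc, ModuleCat.centralSmul_mul, Functor.map_comp, hc, hc, ← ModuleCat.centralSmul_mul]
  · change ModuleCat.centralSmul (c (z + w)) _ = ModuleCat.centralSmul (c z + c w) _
    rw [← hc, ModuleCat.centralSmul_add, Functor.map_add, hc, hc, ← ModuleCat.centralSmul_add]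

end CategoryTheory.Equivalence

namespace ModuleCat

variable {R' : Type u} [Ring R'] {f : R →+* R'}

theorem restrictScalars_full_of_surjective (hf : Function.Surjective f) :
    (restrictScalars.{u} f).Full where
  map_surjective {M N} g :=
    ⟨ofHom
      { toFun := fun m => g.hom m
        map_add' := fun x y => g.hom.map_add x y
        map_smul' := fun r m => by
          obtain ⟨r, rfl⟩ := hf r
          exact g.hom.map_smul r m }, rfl⟩

theorem essImage_restrictScalars_of_addEquiv {M : ModuleCat.{u} R} {N : ModuleCat.{u} R'}
    (φ : M ≃+ N) (hφ : ∀ (r : R) (m : M), φ (r • m) = f r • φ m) :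
    (restrictScalars.{u} f).essImage M :=
  let i : M ≃ₗ[R] (restrictScalars.{u} f).obj N := { φ with map_smul' := hφ }
  ⟨N, ⟨i.toModuleIso.symm⟩⟩

theorem mem_essImage_restrictScalars_iff (hf : Function.Surjective f) (M : ModuleCat.{u} R) :
    (restrictScalars.{u} f).essImage M ↔ ∀ r ∈ RingHom.ker f, ∀ m : M, r • m = 0 := by
  constructor
  · rintro ⟨N, ⟨i⟩⟩ r hr m
    obtain ⟨x, rfl⟩ : ∃ x, i.hom.hom x = m := ⟨i.inv.hom m, by simp⟩
    rw [← map_smul]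
    have : r • x = 0 :=
      (congrArg (fun s => s • (show N from x)) (RingHom.mem_ker.mp hr)).trans
        (zero_smul R' (show N from x))
    rw [this, map_zero]
  · intro h
    let act : R' →+* AddMonoid.End M := f.liftOfSurjective hf
      ⟨Module.toAddMonoidEnd R M, fun r hr => AddMonoidHom.ext (h r hr)⟩
    have hact (r : R) (m : M) : act (f r) m = r • m :=
      DFunLike.congr_fun (f.liftOfSurjective_comp_apply hf _ r) m
    let inst : Module R' M := Module.compHom M act
    exact essImage_restrictScalars_of_addEquiv (N := ModuleCat.of R' M) (AddEquiv.refl M)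
      fun r m => (hact r m).symm

end ModuleCat

/-- Let `R ≌ S` be a Morita equivalence and `e` the induced isomorphism of centers. If `R'` and `S'`
are the quotients of `R` and `S` by ideals generated by central elements `zᵢ` and `e(zᵢ)`, then `R'`
and `S'` are Morita equivalent. -/
theorem nonempty_equivalence_of_central_quotients (F : ModuleCat.{u} R ≌ ModuleCat.{u} S)
    (e : Subring.center R ≃+* Subring.center S)
    (he : ∀ z M, F.functor.map (ModuleCat.centralSmul z M) =
      ModuleCat.centralSmul (e z) (F.functor.obj M))
    {R' S' : Type u} [Ring R'] [Ring S'] {f : R →+* R'} {g : S →+* S'}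
    (hf : Function.Surjective f) (hg : Function.Surjective g)
    {ι : Type*} (z : ι → Subring.center R)
    (hfz : RingHom.ker f = Ideal.span (Set.range fun i => (z i : R)))
    (hgz : RingHom.ker g = Ideal.span (Set.range fun i => (e (z i) : S))) :
    Nonempty (ModuleCat.{u} R' ≌ ModuleCat.{u} S') := by
  have := ModuleCat.restrictScalars_full_of_surjective hf
  have := ModuleCat.restrictScalars_full_of_surjective hg
  have key {T : Type u} [Ring T] (w : ι → Subring.center T) (M : ModuleCat.{u} T) :
      (∀ r ∈ Ideal.span (Set.range fun i => (w i : T)), ∀ m : M, r • m = 0) ↔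
        ∀ i, ModuleCat.centralSmul (w i) M = 0 := by
    simp only [ModuleCat.centralSmul_eq_zero_iff]
    refine ⟨fun h i => h _ (Ideal.subset_span ⟨i, rfl⟩), fun h r hr m => ?_⟩
    induction hr using Submodule.span_induction with
    | mem x hx =>
      obtain ⟨i, rfl⟩ := hx
      exact h i m
    | zero => exact zero_smul _ _
    | add x y _ _ hx hy => rw [add_smul, hx, hy, add_zero]
    | smul a x _ hx => rw [smul_eq_mul, mul_smul, hx, smul_zero]
  have himage : (ModuleCat.restrictScalars.{u} g).essImage.inverseImage F.functor =
      (ModuleCat.restrictScalars.{u} f).essImage := by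
    have : F.functor.Additive := Functor.additive_of_preserves_binary_products _
    ext M
    rw [ObjectProperty.prop_inverseImage_iff, ModuleCat.mem_essImage_restrictScalars_iff hf,
      ModuleCat.mem_essImage_restrictScalars_iff hg, hfz, hgz, key, key]
    simp only [← he, Functor.map_eq_zero_iff]
  exact ⟨(ModuleCat.restrictScalars.{u} f).toEssImage.asEquivalence.trans
    ((F.congrFullSubcategory himage).trans
      (ModuleCat.restrictScalars.{u} g).toEssImage.asEquivalence.symm)⟩

end CenterOfModuleCat

theorem RingHom.ker_op_eq_span {R S ι : Type*} [Ring R] [Ring S] (ρ : R →+* S)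
    (z : ι → Subring.center R) (h : RingHom.ker ρ = Ideal.span (Set.range fun i => (z i : R))) :
    RingHom.ker (RingHom.op ρ) =
      Ideal.span (Set.range fun i => (Subring.centerToMulOpposite (z i) : Rᵐᵒᵖ)) := by
  apply le_antisymm
  · intro r hr
    have hr' : r.unop ∈ Ideal.span (Set.range fun i => (z i : R)) := by
      rw [← h, RingHom.mem_ker]
      exact congrArg MulOpposite.unop hr
    rw [← MulOpposite.op_unop r]
    generalize r.unop = s at hr'
    induction hr' using Submodule.closure_induction with
    | zero => exact Submodule.zero_mem _
    | add x y _ _ hx hy =>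
      rw [MulOpposite.op_add]
      exact Submodule.add_mem _ hx hy
    | smul_mem a x hx =>
      obtain ⟨i, rfl⟩ := hx
      rw [smul_eq_mul, Subring.mem_center_iff.mp (z i).2 a, MulOpposite.op_mul]
      exact Ideal.mul_mem_left _ _ (Ideal.subset_span ⟨i, rfl⟩)
  · rw [Ideal.span_le]
    rintro _ ⟨i, rfl⟩
    have : ρ (z i) = 0 := RingHom.mem_ker.mp (h ▸ Ideal.subset_span ⟨i, rfl⟩)
    exact congrArg MulOpposite.op this

namespace PolyExt

variable {A B : Type u} [Ring A] [Ring B] {n : ℕ}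

/-- The `i`-th indeterminate of `A[t₁,…,tₙ]`, as a central element. -/
noncomputable def centralX (A : Type u) [Ring A] (n : ℕ) (i : Fin n) :
    Subring.center (PolyExt A n) :=
  centerEquiv A n (MvPolynomial.X i)

theorem exists_retraction (A : Type u) [Ring A] (n : ℕ) :
    ∃ ε : PolyExt A n →+* A, (∀ a, ε (AddMonoidAlgebra.single 0 a) = a) ∧
      RingHom.ker ε = Ideal.span (Set.range fun i => (centralX A n i : PolyExt A n)) :=
  exists_retraction_of_bijective (AlgHom.id _ _) Function.bijective_id

/-- If the center of `A` is generated by units modulo nilpotents, then for every isomorphism `e`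
from the center of `A[t₁,…,tₙ]` to that of `B[t₁,…,tₙ]`, the quotient
`B[t₁,…,tₙ] / (e(t₁),…,e(tₙ))` is `B`. -/
theorem exists_retraction_of_centerEquiv (hA : GeneratedByUnitsAndNilpotents (Subring.center A))
    (e : Subring.center (PolyExt A n) ≃+* Subring.center (PolyExt B n)) :
    ∃ ρ : PolyExt B n →+* B, (∀ b, ρ (AddMonoidAlgebra.single 0 b) = b) ∧
      RingHom.ker ρ = Ideal.span (Set.range fun i => (e (centralX A n i) : PolyExt B n)) := by
  let φ := ((centerEquiv A n).trans e).trans (centerEquiv B n).symm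
  obtain ⟨ρ, hρ, hker⟩ :=
    exists_retraction_of_bijective _ (MvPolynomial.bijective_aeval_of_ringEquiv hA φ)
  refine ⟨ρ, hρ, ?_⟩
  have hφ (i) : ofCenter B n (φ (MvPolynomial.X i)) = e (centralX A n i) := by
    rw [← coe_centerEquiv]
    exact congrArg Subtype.val ((centerEquiv B n).apply_symm_apply _)
  simpa only [MvPolynomial.aeval_X, hφ] using hker

theorem nonempty_algEquiv_of_generatedByUnitsAndNilpotents {k : Type u} [Field k] [Algebra k A]
    [Algebra k B] (hA : GeneratedByUnitsAndNilpotents (Subring.center A))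
    (φ : PolyExt A n ≃ₐ[k] PolyExt B n) : Nonempty (A ≃ₐ[k] B) := by
  obtain ⟨ε, hε, hεker⟩ := exists_retraction A n
  obtain ⟨ρ, hρ, hρker⟩ :=
    exists_retraction_of_centerEquiv hA (Subring.centerCongr φ.toRingEquiv)
  have hker (f : PolyExt A n) : ρ (φ f) = 0 ↔ ε f = 0 := by
    rw [← RingHom.mem_ker, ← RingHom.mem_ker, hρker, hεker]
    have : (Set.range fun i => (Subring.centerCongr φ.toRingEquiv (centralX A n i) : PolyExt B n)) =
        φ.toRingEquiv '' Set.range fun i => (centralX A n i : PolyExt A n) := by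
      rw [← Set.range_comp]
      rfl
    rw [this, ← Ideal.map_span, Ideal.mem_map_of_equiv]
    exact ⟨fun ⟨g, hg, hgf⟩ => φ.injective hgf ▸ hg, fun hf => ⟨f, hf, rfl⟩⟩
  let ρ' : PolyExt B n →ₐ[k] B := { ρ with commutes' := fun r => hρ _ }
  let α : A →ₐ[k] B := (ρ'.comp φ.toAlgHom).comp (PolyExt.C k A n)
  have hα (f : PolyExt A n) : α (ε f) = ρ (φ f) := by
    have h : ρ (φ (AddMonoidAlgebra.single 0 (ε f) - f)) = 0 := by
      rw [hker, map_sub, hε, sub_self]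
    rwa [map_sub, map_sub, sub_eq_zero] at h
  refine ⟨AlgEquiv.ofBijective α ⟨?_, fun b => ?_⟩⟩
  · rw [injective_iff_map_eq_zero]
    intro a ha
    rw [← hε a, ← hker]
    exact ha
  · refine ⟨ε (φ.symm (AddMonoidAlgebra.single 0 b)), ?_⟩
    rw [hα, φ.apply_symm_apply, hρ]

theorem moritaEquivalent_of_generatedByUnitsAndNilpotents
    (hA : GeneratedByUnitsAndNilpotents (Subring.center A))
    (h : MoritaEquivalent (PolyExt A n) (PolyExt B n)) : MoritaEquivalent A B := by
  obtain ⟨F⟩ := h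
  obtain ⟨e, he⟩ := F.exists_centerEquiv
  obtain ⟨ε, hε, hεker⟩ := exists_retraction A n
  obtain ⟨ρ, hρ, hρker⟩ := exists_retraction_of_centerEquiv hA
    ((Subring.centerToMulOpposite.trans e).trans Subring.centerToMulOpposite.symm)
  refine nonempty_equivalence_of_central_quotients F e he (f := RingHom.op ε) (g := RingHom.op ρ)
    (fun a => ⟨.op (AddMonoidAlgebra.single 0 a.unop), congrArg MulOpposite.op (hε _)⟩)
    (fun b => ⟨.op (AddMonoidAlgebra.single 0 b.unop), congrArg MulOpposite.op (hρ _)⟩)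
    (fun i => Subring.centerToMulOpposite (centralX A n i))
    (ε.ker_op_eq_span _ hεker) ((ρ.ker_op_eq_span _ hρker).trans ?_)
  simp only [RingEquiv.trans_apply, RingEquiv.apply_symm_apply]

end PolyExt

/-- If `Z/N(Z)` is generated as a `k`-algebra by a set of units,
then `A` is strongly cancellative and strongly Morita cancellative. -/
theorem strongly_cancellative_of_center_mod_nilradical_generated_by_units
    (k A : Type u) [Field k] [Ring A] [Algebra k A]
    (h : ∃ S : Set ((Subalgebra.center k A) ⧸ nilradical (Subalgebra.center k A)),
      (∀ s ∈ S, IsUnit s) ∧ Algebra.adjoin k S = ⊤) :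
    StronglyCancellative k A ∧ StronglyMoritaCancellative k A := by
  let e : Subalgebra.center k A ≃+* Subring.center A :=
    { toFun := fun z => ⟨z, z.2⟩
      invFun := fun z => ⟨z, z.2⟩
      map_mul' := fun _ _ => rfl
      map_add' := fun _ _ => rfl }
  have hA := (generatedByUnitsAndNilpotents_of_quotient h).of_ringEquiv e
  exact ⟨fun n _ B _ _ ⟨φ⟩ => PolyExt.nonempty_algEquiv_of_generatedByUnitsAndNilpotents hA φ,
    fun n _ B _ _ hM => PolyExt.moritaEquivalent_of_generatedByUnitsAndNilpotents hA hM⟩
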